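/- For any v ∈ V_d there exists a chain V = (v_0, …, v_d) of length d+1 whose top element satisfies v_d = v. -/

import Mathlib

open Polynomial

/-- The falling factorial polynomial `(x)_j = x(x-1)⋯(x-j+1)`. -/
noncomputable def fall (j : ℕ) : Polynomial ℝ :=
  ∏ k ∈ Finset.range j, (X - C (k : ℝ))

/-- The normalized falling factorial `[x]_j = (x)_j / j!`. -/
noncomputable def nfall (j : ℕ) : Polynomial ℝ :=
  ((j.factorial : ℝ))⁻¹ • fall j

/-- The forward difference operator `Δp(x) = p(x+1) - p(x)`. -/
noncomputable def fdiff (p : Polynomial ℝ) : Polynomial ℝ :=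
  p.comp (X + 1) - p

/-- Action of a generalized complete Taylor operator with constant coefficients `s`
on a vector of polynomials `v`, indexed by degree: the component of degree `j` is
`Δ(v j) + ∑_{k<j} s j k • v k`.  (In the matrix picture, the constants `s j k`, `k < j`,
are the strictly upper triangular entries of the operator written for the reversed
vector `[v_d, …, v_0]`; `s j (j-1) = -1` corresponds to the `-1` superdiagonal.) -/
noncomputable def tApply (s : ℕ → ℕ → ℝ) (v : ℕ → Polynomial ℝ) (j : ℕ) : Polynomial ℝ :=
  fdiff (v j) + ∑ k ∈ Finset.range j, C (s j k) * v k

/-- `s` encodes a generalized complete Taylor operator of order `d`: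
only the entries `s j k` with `k < j ≤ d` may be nonzero, and the entries
corresponding to the superdiagonal (in the reversed ordering) equal `-1`. -/
def IsTaylorOp (d : ℕ) (s : ℕ → ℕ → ℝ) : Prop :=
  (∀ j k, j ≤ k ∨ d < j → s j k = 0) ∧ ∀ j < d, s (j + 1) j = -1

/-- Membership in `V_d`: `v = (v_d, …, v_0)` with `v_j = [·]_j + u_j`, `deg u_j ≤ j - 1`
(so in particular `v_0 = 1`). -/
def MemV (d : ℕ) (v : ℕ → Polynomial ℝ) : Prop :=
  ∀ j ≤ d, (v j - nfall j).degree < (j : WithBot ℕ)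

/-- `s` annihilates the polynomial vector `v` up to order `d`: `T̃ v = 0`. -/
def Annihilates (d : ℕ) (s : ℕ → ℕ → ℝ) (v : ℕ → Polynomial ℝ) : Prop :=
  ∀ j ≤ d, tApply s v j = 0

/-- `V = (v_0, …, v_d)` (with `V j k` the degree-`k` component of `v_j`) is a chain of
length `d+1`: each `v_j ∈ V_j` and the compatibility condition holds, i.e. applying the
annihilator `T̃(v_j)` of `v_j` to the shifted vector `(v_{j+1,j+1}, …, v_{j+1,1})`
yields a vector of constant polynomials. -/
def IsPolyChain (d : ℕ) (V : ℕ → ℕ → Polynomial ℝ) : Prop :=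
  (∀ j ≤ d, MemV j (V j)) ∧
    ∀ j < d, ∀ s : ℕ → ℕ → ℝ, IsTaylorOp j s → Annihilates j s (V j) →
      ∀ i ≤ j, ∃ c : ℝ, tApply s (fun k => V (j + 1) (k + 1)) i = C c

theorem fdiff_sub (p q : ℝ[X]) : fdiff (p - q) = fdiff p - fdiff q := by
  simp only [fdiff, sub_comp]; ring

theorem fdiff_fall_succ (j : ℕ) : fdiff (fall (j + 1)) = C ((j : ℝ) + 1) * fall j := by
  have h : (fall (j + 1)).comp (X + 1) = (X + 1) * fall j := by
    rw [fall, Polynomial.prod_comp, Finset.prod_range_succ', mul_comm]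
    congr 1
    · simp
    · refine Finset.prod_congr rfl fun k _ => ?_
      simp
  rw [fdiff, h, fall, fall, Finset.prod_range_succ]
  simp only [C_add, C_1]
  ring

theorem fdiff_nfall_succ (j : ℕ) : fdiff (nfall (j + 1)) = nfall j := by
  have h : fdiff (nfall (j + 1)) = (((j + 1).factorial : ℝ))⁻¹ • fdiff (fall (j + 1)) := by
    simp only [nfall, fdiff, smul_comp, smul_sub]
  rw [h, fdiff_fall_succ, ← smul_eq_C_mul, smul_smul, nfall, Nat.factorial_succ]
  congr 1
  have : (j : ℝ) + 1 ≠ 0 := by positivity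
  push_cast
  field_simp

theorem degree_fdiff_lt {p : ℝ[X]} (hp : p ≠ 0) : (fdiff p).degree < p.degree := by
  have h : p.comp (X + 1) = taylor 1 p := by simp [taylor_apply]
  have hd : (taylor (1 : ℝ) p).degree = p.degree := degree_taylor p 1
  rw [fdiff, h, ← hd]
  exact degree_sub_lt_left hd (by simpa using hp) (by simp)

theorem degree_fdiff_lt_of_lt_succ {p : ℝ[X]} {j : ℕ}
    (hp : p.degree < ((j + 1 : ℕ) : WithBot ℕ)) : (fdiff p).degree < (j : WithBot ℕ) := by
  by_cases h0 : p = 0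
  · simp [h0, fdiff]
  · refine (degree_fdiff_lt h0).trans_le ?_
    rw [degree_eq_natDegree h0] at hp ⊢
    exact_mod_cast Nat.lt_succ_iff.mp (by exact_mod_cast hp)

theorem degree_iterate_fdiff_sub_nfall_lt (m k : ℕ) (p : ℝ[X])
    (hp : (p - nfall (k + m)).degree < ((k + m : ℕ) : WithBot ℕ)) :
    (fdiff^[m] p - nfall k).degree < (k : WithBot ℕ) := by
  induction m generalizing k with
  | zero => exact hp
  | succ m ih =>
    rw [Function.iterate_succ_apply', ← fdiff_nfall_succ, ← fdiff_sub]
    refine degree_fdiff_lt_of_lt_succ (ih (k + 1) ?_)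
    rwa [Nat.add_right_comm]

theorem eq_C_of_fdiff_eq_zero {p : ℝ[X]} (hp : fdiff p = 0) : p = C (p.eval 0) := by
  have h (n : ℕ) : p.eval (n : ℝ) = p.eval 0 := by
    induction n with
    | zero => simp
    | succ n ih =>
      have := congrArg (eval (n : ℝ)) hp
      simp only [fdiff, eval_sub, eval_comp, eval_add, eval_X, eval_one, eval_zero] at this
      push_cast
      linarith
  refine eq_of_infinite_eval_eq _ _ ((Set.infinite_range_of_injective
    (Nat.cast_injective (R := ℝ))).mono ?_)
  rintro _ ⟨n, rfl⟩
  simp [h]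

theorem fdiff_tApply (s : ℕ → ℕ → ℝ) (v : ℕ → ℝ[X]) (j : ℕ) :
    fdiff (tApply s v j) = tApply s (fun k => fdiff (v k)) j := by
  simp only [tApply, fdiff, add_comp, sub_comp, Polynomial.sum_comp, Polynomial.mul_comp, C_comp,
    mul_sub, Finset.sum_sub_distrib]
  ring

/-- Every `v ∈ V_d` is the top element of some chain of length `d+1`. -/
theorem exists_chain_with_top (d : ℕ) (v : ℕ → Polynomial ℝ) (hv : MemV d v) :
    ∃ V : ℕ → ℕ → Polynomial ℝ, IsPolyChain d V ∧ ∀ k ≤ d, V d k = v k := by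
  refine ⟨fun j k => fdiff^[d - j] (v (k + (d - j))), ⟨fun j hj k hk =>
    degree_iterate_fdiff_sub_nfall_lt _ _ _ (hv _ (by omega)), ?_⟩, fun k _ => by simp⟩
  intro j hj s _ hs i hi
  refine ⟨_, eq_C_of_fdiff_eq_zero ?_⟩
  rw [fdiff_tApply, ← hs i hi]
  congr 1
  funext k
  obtain ⟨m, rfl⟩ := Nat.exists_eq_add_of_lt hj
  have h₁ : j + m + 1 - (j + 1) = m := by omega
  have h₂ : j + m + 1 - j = m + 1 := by omega
  simp only [h₁, h₂, Function.iterate_succ_apply']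
  rw [add_assoc, add_comm 1 m]
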